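/- arXiv:2509.10061 — 2 statements merged into one kernel-verified Lean document; each statement's English description precedes it below -/
import Mathlib

section
/- Fix q ∈ [0,1] and set C = |1 − 2q|. Define, for w, z ∈ [0,1]: I(w,z) = h₂((w+z)/2) − (h₂(w) + h₂(z))/2, Γ(w,z) = (1 + z − w)/2, and Λ(w,z) = C·( wz/(w+z) + (1−w)(1−z)/(2−w−z) ), where any fraction with zero denominator is taken to be 0. For D_o ∈ [0,1] let a(D_o) = 2C·D_o(1−D_o) if 0 ≤ D_o ≤ 1/2 and a(D_o) = C/2 if 1/2 < D_o ≤ 1, and define R(D_p, D_o) = inf { I(w,z) : w, z ∈ [0,1], Λ(w,z) ≤ D_p, Γ(w,z) ≤ D_o }. Then for every D_o ∈ [0,1] and every D_p ∈ (a(D_o), 1], R(D_p, D_o) = 1 − h₂( min{D_o, 1/2} ). -/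
/-- Binary entropy function with base-2 logarithm (with `h₂ 0 = h₂ 1 = 0` by the
Lean convention `logb 2 0 = 0`). -/
noncomputable def binEnt (x : ℝ) : ℝ :=
  -(x * Real.logb 2 x) - (1 - x) * Real.logb 2 (1 - x)

/-- Mutual information `I(w,z)` of the binary test channel `[[w,1−w],[z,1−z]]`
with uniform input. -/
noncomputable def mutI (w z : ℝ) : ℝ :=
  binEnt ((w + z) / 2) - (binEnt w + binEnt z) / 2

/-- Expected total-variation semantic distortion `Λ(w,z)` (fractions with zero
denominator are `0` by the Lean convention `a / 0 = 0`). -/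
noncomputable def lamTV (C w z : ℝ) : ℝ :=
  C * (w * z / (w + z) + (1 - w) * (1 - z) / (2 - w - z))

/-- Expected Hamming distortion `Γ(w,z)`. -/
noncomputable def gamH (w z : ℝ) : ℝ := (1 + z - w) / 2

/-- The threshold `a(D_o)`. -/
noncomputable def aThresh (C Do_ : ℝ) : ℝ :=
  if Do_ ≤ 1 / 2 then 2 * C * Do_ * (1 - Do_) else C / 2

/-- The semantic rate distortion function `R(D_p, D_o)` for the binary case. -/
noncomputable def Rbin (C Dp Do_ : ℝ) : ℝ :=
  sInf {r : ℝ | ∃ w z : ℝ, w ∈ Set.Icc (0 : ℝ) 1 ∧ z ∈ Set.Icc (0 : ℝ) 1 ∧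
    lamTV C w z ≤ Dp ∧ gamH w z ≤ Do_ ∧ r = mutI w z}

open Real in
theorem binEnt_eq_binEntropy_div (x : ℝ) : binEnt x = binEntropy x / log 2 := by
  simp only [binEnt, logb, binEntropy_eq_negMulLog_add_negMulLog_one_sub, negMulLog]
  ring

theorem binEnt_half : binEnt (1 / 2) = 1 := by
  rw [binEnt_eq_binEntropy_div, one_div, Real.binEntropy_two_inv,
    div_self (Real.log_pos one_lt_two).ne']

theorem binEnt_one_sub (x : ℝ) : binEnt (1 - x) = binEnt x := by
  simp [binEnt_eq_binEntropy_div]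

theorem binEnt_le_binEnt_min_half {x d : ℝ} (hx : 0 ≤ x) (hxd : x ≤ d) :
    binEnt x ≤ binEnt (min d (1 / 2)) := by
  rcases le_total x (1 / 2) with h | h
  · have hm : x ≤ min d (1 / 2) := le_min hxd h
    have hmono := Real.binEntropy_strictMonoOn.monotoneOn
      (a := x) (b := min d (1 / 2)) ⟨hx, by linarith⟩
      ⟨hx.trans hm, by linarith [min_le_right d (1 / 2 : ℝ)]⟩ hm
    rw [binEnt_eq_binEntropy_div, binEnt_eq_binEntropy_div]
    exact div_le_div_of_nonneg_right hmono (Real.log_nonneg one_le_two)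
  · rw [min_eq_right (h.trans hxd), binEnt_half, binEnt_eq_binEntropy_div,
      div_le_one (Real.log_pos one_lt_two)]
    exact Real.binEntropy_le_log_two

open Real in
/-- Grouping property of entropy for two nonnegative masses. -/
theorem add_mul_binEntropy_div_add {a b : ℝ} (ha : 0 ≤ a) (hb : 0 ≤ b) :
    (a + b) * binEntropy (b / (a + b)) = negMulLog a + negMulLog b - negMulLog (a + b) := by
  rcases ha.eq_or_lt with rfl | ha
  · rcases eq_or_ne b 0 with rfl | h <;> simp [*]
  rcases hb.eq_or_lt with rfl | hb
  · simp
  have hab : a + b ≠ 0 := by positivity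
  have h : 1 - b / (a + b) = a / (a + b) := by field_simp; ring
  rw [binEntropy_eq_negMulLog_add_negMulLog_one_sub, h]
  simp only [negMulLog, log_div ha.ne' hab, log_div hb.ne' hab]
  field_simp
  ring

open Real in
theorem binEntropy_eq_two_mul_negMulLog_half (x : ℝ) :
    binEntropy x = 2 * negMulLog (x / 2) + 2 * negMulLog ((1 - x) / 2) - log 2 := by
  have h (y : ℝ) : negMulLog y = 2 * negMulLog (y / 2) - y * log 2 := by
    have := negMulLog_mul (y / 2) 2
    rw [div_mul_cancel₀ y two_ne_zero] at this
    have h2 : negMulLog 2 = -2 * log 2 := rfl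
    rw [this, h2]
    ring
  rw [binEntropy_eq_negMulLog_add_negMulLog_one_sub, h x, h (1 - x)]
  ring

open Real in
/-- Fano's inequality for the binary test channel with uniform input. -/
theorem one_sub_binEnt_gamH_le_mutI {w z : ℝ} (hw : w ∈ Set.Icc (0 : ℝ) 1)
    (hz : z ∈ Set.Icc (0 : ℝ) 1) : 1 - binEnt (gamH w z) ≤ mutI w z := by
  obtain ⟨hw0, hw1⟩ := hw
  obtain ⟨hz0, hz1⟩ := hz
  have ha : 0 ≤ w / 2 := by linarith
  have hb : 0 ≤ z / 2 := by linarith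
  have hc : 0 ≤ (1 - w) / 2 := by linarith
  have hd : 0 ≤ (1 - z) / 2 := by linarith
  have mem {x y : ℝ} (hx : 0 ≤ x) (hy : 0 ≤ y) : y / (x + y) ∈ Set.Icc (0 : ℝ) 1 :=
    ⟨by positivity, div_le_one_of_le₀ (by linarith) (by positivity)⟩
  have cancel {x y : ℝ} (hx : 0 ≤ x) (hy : 0 ≤ y) : (x + y) * (y / (x + y)) = y :=
    mul_div_cancel_of_imp' fun h => by linarith
  have jensen := strictConcave_binEntropy.concaveOn.2 (mem ha hb) (mem hd hc)
    (add_nonneg ha hb) (add_nonneg hd hc) (by ring)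
  simp only [smul_eq_mul] at jensen
  rw [cancel ha hb, cancel hd hc, add_mul_binEntropy_div_add ha hb,
    add_mul_binEntropy_div_add hd hc] at jensen
  have hg : z / 2 + (1 - w) / 2 = gamH w z := by unfold gamH; ring
  have hP : w / 2 + z / 2 = (w + z) / 2 := by ring
  have hQ : (1 - z) / 2 + (1 - w) / 2 = 1 - (w + z) / 2 := by ring
  rw [hg, hP, hQ] at jensen
  have hl : 0 < log 2 := log_pos one_lt_two
  have key : log 2 - binEntropy (gamH w z) ≤
      binEntropy ((w + z) / 2) - (binEntropy w + binEntropy z) / 2 := by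
    rw [binEntropy_eq_two_mul_negMulLog_half w, binEntropy_eq_two_mul_negMulLog_half z,
      binEntropy_eq_negMulLog_add_negMulLog_one_sub ((w + z) / 2)]
    linarith
  simp only [mutI, binEnt_eq_binEntropy_div]
  have := div_le_div_of_nonneg_right key hl.le
  rw [sub_div, div_self hl.ne'] at this
  refine this.trans_eq ?_
  ring

theorem mutI_one_sub_self (m : ℝ) : mutI (1 - m) m = 1 - binEnt m := by
  rw [mutI, binEnt_one_sub, sub_add_cancel, binEnt_half]
  ring

theorem lamTV_one_sub_self (C m : ℝ) : lamTV C (1 - m) m = 2 * C * m * (1 - m) := by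
  rw [lamTV, sub_add_cancel, show 2 - (1 - m) - m = 1 by ring]
  ring

theorem aThresh_eq_min_half (C d : ℝ) :
    aThresh C d = 2 * C * min d (1 / 2) * (1 - min d (1 / 2)) := by
  unfold aThresh
  split_ifs with h
  · rw [min_eq_left h]
  · rw [min_eq_right (le_of_not_ge h)]
    ring

/-- Theorem 3, second branch: for `D_p ∈ (a(D_o), 1]` the binary semantic rate
distortion function equals `1 − h₂(min{D_o, 1/2})`. -/
theorem binary_rate_distortion_large_Dp
    (q : ℝ) (hq : q ∈ Set.Icc (0 : ℝ) 1)
    (C : ℝ) (hC : C = |1 - 2 * q|)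
    (Do_ : ℝ) (hDo : Do_ ∈ Set.Icc (0 : ℝ) 1)
    (Dp : ℝ) (hDp : Dp ∈ Set.Ioc (aThresh C Do_) 1) :
    Rbin C Dp Do_ = 1 - binEnt (min Do_ (1 / 2)) := by
  refine IsLeast.csInf_eq ⟨⟨1 - min Do_ (1 / 2), min Do_ (1 / 2), ?_, ?_, ?_, ?_, ?_⟩, ?_⟩
  · have := le_min hDo.1 (one_half_pos (α := ℝ)).le
    constructor <;> linarith [min_le_right Do_ (1 / 2 : ℝ)]
  · exact ⟨le_min hDo.1 (by norm_num), by linarith [min_le_right Do_ (1 / 2 : ℝ)]⟩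
  · rw [lamTV_one_sub_self, ← aThresh_eq_min_half]
    exact hDp.1.le
  · unfold gamH
    linarith [min_le_left Do_ (1 / 2 : ℝ)]
  · exact (mutI_one_sub_self _).symm
  · rintro r ⟨w, z, hw, hz, -, hg, rfl⟩
    have h0 : 0 ≤ gamH w z := by
      unfold gamH
      linarith [hw.2, hz.1]
    linarith [one_sub_binEnt_gamH_le_mutI hw hz, binEnt_le_binEnt_min_half h0 hg]
end

section
/- Fix C > 0 and D_o ∈ [0, 1/2), and define φ(z) = Λ(z + 1 − 2D_o, z) for z ∈ [0, 2D_o], where Λ(w,z) = C·( wz/(w+z) + (1−w)(1−z)/(2−w−z) ) with the convention that fractions with zero denominator are 0. Then φ attains its maximum over [0, 2D_o] at z = D_o, and φ(D_o) = 2C·D_o(1−D_o); equivalently, Λ(z + 1 − 2D_o, z) ≤ 2C·D_o(1−D_o) for every z ∈ [0, 2D_o]. -/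
theorem lamTV_eq (C : ℝ) {w z : ℝ} (h₀ : 0 < w + z) (h₂ : 0 < 2 - w - z) :
    lamTV C w z = C * (1 / 2 - (w - z) ^ 2 / (2 * ((w + z) * (2 - w - z)))) := by
  have h₀' := h₀.ne'
  have h₂' := h₂.ne'
  unfold lamTV
  field_simp
  ring

theorem lamTV_le {C : ℝ} (hC : 0 ≤ C) {w z : ℝ} (h₀ : 0 < w + z) (h₂ : 0 < 2 - w - z) :
    lamTV C w z ≤ C * (1 / 2 - (w - z) ^ 2 / 2) := by
  rw [lamTV_eq C h₀ h₂]
  have hpos : 0 < (w + z) * (2 - w - z) := mul_pos h₀ h₂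
  have hle : (w + z) * (2 - w - z) ≤ 1 := by nlinarith [sq_nonneg (w + z - 1)]
  gcongr
  linarith

/-- On the boundary curve `w = z + 1 − 2D_o`, `z ∈ [0, 2D_o]`, of the Hamming
constraint, the map `φ(z) = Λ(z + 1 − 2D_o, z)` attains its maximum at `z = D_o`,
with maximal value `2C·D_o(1−D_o)`. -/
theorem lambda_on_boundary_max_at_Do
    (C : ℝ) (hC : 0 < C)
    (Do_ : ℝ) (hDo : Do_ ∈ Set.Ico (0 : ℝ) (1 / 2)) :
    (∀ z ∈ Set.Icc (0 : ℝ) (2 * Do_),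
        lamTV C (z + 1 - 2 * Do_) z ≤ lamTV C (Do_ + 1 - 2 * Do_) Do_) ∧
    lamTV C (Do_ + 1 - 2 * Do_) Do_ = 2 * C * Do_ * (1 - Do_) ∧
    ∀ z ∈ Set.Icc (0 : ℝ) (2 * Do_),
      lamTV C (z + 1 - 2 * Do_) z ≤ 2 * C * Do_ * (1 - Do_) := by
  obtain ⟨hD₀, hD₁⟩ := hDo
  have hval : lamTV C (Do_ + 1 - 2 * Do_) Do_ = 2 * C * Do_ * (1 - Do_) := by
    rw [lamTV, show Do_ + 1 - 2 * Do_ + Do_ = 1 by ring,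
      show 2 - (Do_ + 1 - 2 * Do_) - Do_ = 1 by ring]
    ring
  have hbound : ∀ z ∈ Set.Icc (0 : ℝ) (2 * Do_),
      lamTV C (z + 1 - 2 * Do_) z ≤ 2 * C * Do_ * (1 - Do_) := by
    rintro z ⟨hz₀, hz₁⟩
    calc lamTV C (z + 1 - 2 * Do_) z
        ≤ C * (1 / 2 - (z + 1 - 2 * Do_ - z) ^ 2 / 2) :=
          lamTV_le hC.le (by linarith) (by linarith)
      _ = 2 * C * Do_ * (1 - Do_) := by ring
  exact ⟨fun z hz => hval ▸ hbound z hz, hval, hbound⟩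
end
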